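/- arXiv:math-ph/0111040 — 5 statements merged into one kernel-verified Lean document; each statement's English description precedes it below -/
import Mathlib

section
/- Let n, k ≥ 1. Define, for an invertible n×n real matrix N, an invertible k×k real matrix K, a k×n real matrix A, an n×k real matrix B, and λ ∈ ℝ: (N,K,A) • (B,λ) := (det N)⁻¹ • (N * B * K⁻¹, λ − trace (B * K⁻¹ * A)). Then this defines a linear left action of the adapted linear group on (Matrix (Fin n) (Fin k) ℝ) × ℝ: (i) (1,1,0) • (B,λ) = (B,λ); (ii) for all (N₁,K₁,A₁) and (N₂,K₂,A₂), one has (N₁,K₁,A₁) • ((N₂,K₂,A₂) • (B,λ)) = (N₁*N₂, K₁*K₂, A₁*N₂ + K₁*A₂) • (B,λ); (iii) for each fixed (N,K,A), the map (B,λ) ↦ (N,K,A) • (B,λ) is ℝ-linear. -/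
open Matrix

/-- The prescribed action of the adapted linear group element `(N, K, A)` on a pair
`(B, λ)`:  `(N,K,A) • (B,λ) = (det N)⁻¹ • (N B K⁻¹, λ − tr (B K⁻¹ A))`. -/
noncomputable def adaptedAct {n k : ℕ} (N : Matrix (Fin n) (Fin n) ℝ) (K : Matrix (Fin k) (Fin k) ℝ)
    (A : Matrix (Fin k) (Fin n) ℝ) (p : Matrix (Fin n) (Fin k) ℝ × ℝ) :
    Matrix (Fin n) (Fin k) ℝ × ℝ :=
  (N.det)⁻¹ • (N * p.1 * K⁻¹, p.2 - (p.1 * K⁻¹ * A).trace)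

/-- `adaptedAct` is a linear left action of the adapted linear group on
`(Matrix (Fin n) (Fin k) ℝ) × ℝ`: the identity `(1,1,0)` acts trivially, the action is
compatible with the group law `(N₁,K₁,A₁)(N₂,K₂,A₂) = (N₁N₂, K₁K₂, A₁N₂ + K₁A₂)`,
and each `(N,K,A)` acts `ℝ`-linearly. -/
theorem adaptedAct_is_linear_left_action (n k : ℕ) (hn : 1 ≤ n) (hk : 1 ≤ k) :
    (∀ p : Matrix (Fin n) (Fin k) ℝ × ℝ,
      adaptedAct (1 : Matrix (Fin n) (Fin n) ℝ) (1 : Matrix (Fin k) (Fin k) ℝ) 0 p = p) ∧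
    (∀ (N₁ N₂ : Matrix (Fin n) (Fin n) ℝ) (K₁ K₂ : Matrix (Fin k) (Fin k) ℝ)
        (A₁ A₂ : Matrix (Fin k) (Fin n) ℝ),
      IsUnit N₁ → IsUnit K₁ → IsUnit N₂ → IsUnit K₂ →
      ∀ p : Matrix (Fin n) (Fin k) ℝ × ℝ,
        adaptedAct N₁ K₁ A₁ (adaptedAct N₂ K₂ A₂ p) =
          adaptedAct (N₁ * N₂) (K₁ * K₂) (A₁ * N₂ + K₁ * A₂) p) ∧
    (∀ (N : Matrix (Fin n) (Fin n) ℝ) (K : Matrix (Fin k) (Fin k) ℝ)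
        (A : Matrix (Fin k) (Fin n) ℝ), IsUnit N → IsUnit K →
      IsLinearMap ℝ (adaptedAct N K A)) := by
  refine ⟨fun p => ?_, fun N₁ N₂ K₁ K₂ A₁ A₂ _ hK₁ _ _ p => ?_, fun N K A _ _ => ⟨?_, ?_⟩⟩
  · simp [adaptedAct]
  · have hK₁_det : IsUnit K₁.det := (Matrix.isUnit_iff_isUnit_det K₁).mp hK₁
    have h_trace : (p.1 * (K₁ * K₂)⁻¹ * (A₁ * N₂ + K₁ * A₂)).trace =
        (N₂ * p.1 * K₂⁻¹ * K₁⁻¹ * A₁).trace + (p.1 * K₂⁻¹ * A₂).trace := by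
      rw [Matrix.mul_inv_rev, Matrix.mul_add, Matrix.trace_add]
      congr 1
      · rw [← Matrix.mul_assoc, Matrix.trace_mul_comm]
        simp only [Matrix.mul_assoc]
      · simp only [Matrix.mul_assoc, Matrix.nonsing_inv_mul_cancel_left K₁ A₂ hK₁_det]
    ext1
    · simp only [adaptedAct, Prod.smul_fst, Matrix.mul_inv_rev, Matrix.det_mul, mul_inv,
        Matrix.mul_smul, Matrix.smul_mul, smul_smul, Matrix.mul_assoc]
    · simp only [adaptedAct, Prod.smul_fst, Prod.smul_snd, h_trace, Matrix.det_mul, mul_inv,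
        Matrix.mul_smul, Matrix.smul_mul, Matrix.trace_smul, smul_eq_mul]
      ring
  · intro p q
    ext1
    · simp only [adaptedAct, Prod.smul_fst, Prod.fst_add, Matrix.mul_add, Matrix.add_mul, smul_add]
    · simp only [adaptedAct, Prod.smul_snd, Prod.fst_add, Prod.snd_add, Matrix.add_mul,
        Matrix.trace_add, smul_eq_mul]
      ring
  · intro c p
    ext1
    · simp only [adaptedAct, Prod.smul_fst, Matrix.mul_smul, Matrix.smul_mul]
      rw [smul_comm]
    · simp only [adaptedAct, Prod.smul_fst, Prod.smul_snd, Matrix.smul_mul, Matrix.trace_smul,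
        smul_eq_mul]
      ring
end

section
/- Let n, k ≥ 1. Let B, B' be nonzero n×k real matrices and λ, λ' ∈ ℝ. Then there exist an invertible n×n real matrix N, an invertible k×k real matrix K, and a k×n real matrix A with (det N)⁻¹ • (N * B * K⁻¹, λ − trace (B * K⁻¹ * A)) = (B', λ') if and only if rank B = rank B'. In other words, the orbits of the adapted-linear-group action on pairs (B,λ) with B ≠ 0 are classified exactly by the rank of B. -/
open Matrix

/-- Two linear maps between finite-dimensional spaces whose ranges have the same dimension are
equivalent up to linear automorphisms of the source and of the target. -/
theorem LinearMap.exists_equiv_comp_eq_of_finrank_range_eq {F V W : Type*} [Field F]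
    [AddCommGroup V] [Module F V] [FiniteDimensional F V]
    [AddCommGroup W] [Module F W] [FiniteDimensional F W] (f g : V →ₗ[F] W)
    (h : Module.finrank F (LinearMap.range f) = Module.finrank F (LinearMap.range g)) :
    ∃ (e : V ≃ₗ[F] V) (e' : W ≃ₗ[F] W), e'.toLinearMap ∘ₗ f = g ∘ₗ e.toLinearMap := by
  obtain ⟨C, hC⟩ := (LinearMap.ker f).exists_isCompl
  obtain ⟨C', hC'⟩ := (LinearMap.ker g).exists_isCompl
  obtain ⟨D, hD⟩ := (LinearMap.range f).exists_isCompl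
  obtain ⟨D', hD'⟩ := (LinearMap.range g).exists_isCompl
  have hker : Module.finrank F (LinearMap.ker f) = Module.finrank F (LinearMap.ker g) := by
    have hf := f.finrank_range_add_finrank_ker
    have hg := g.finrank_range_add_finrank_ker
    lia
  have hD_eq : Module.finrank F D = Module.finrank F D' := by
    have hf := Submodule.finrank_add_eq_of_isCompl hD
    have hg := Submodule.finrank_add_eq_of_isCompl hD'
    lia
  let r := LinearEquiv.ofFinrankEq _ _ h
  let kf := f.kerComplementEquivRange hC.symm
  let kg := g.kerComplementEquivRange hC'.symm
  let p := Submodule.prodEquivOfIsCompl _ _ hC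
  let q := Submodule.prodEquivOfIsCompl _ _ hD
  let e := p.symm ≪≫ₗ (LinearEquiv.ofFinrankEq _ _ hker).prodCongr (kf ≪≫ₗ r ≪≫ₗ kg.symm) ≪≫ₗ
    Submodule.prodEquivOfIsCompl _ _ hC'
  let e' := q.symm ≪≫ₗ r.prodCongr (LinearEquiv.ofFinrankEq _ _ hD_eq) ≪≫ₗ
    Submodule.prodEquivOfIsCompl _ _ hD'
  refine ⟨e, e', LinearMap.ext fun x ↦ ?_⟩
  obtain ⟨⟨u, c⟩, rfl⟩ := p.surjective x
  have hf : f (p (u, c)) = kf c := by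
    simp [p, kf, LinearMap.kerComplementEquivRange]
  have hg (y : LinearMap.range g) : g (kg.symm y) = y :=
    congrArg Subtype.val (kg.apply_symm_apply y)
  have hq : q.symm (kf c : W) = (kf c, 0) := by simp [q]
  simp [hf, hq, e, e', hg]

/-- Matrices of the same size and rank over a field are equivalent. -/
theorem Matrix.exists_isUnit_mul_mul_eq_of_rank_eq {F m l : Type*} [Field F]
    [Fintype m] [DecidableEq m] [Fintype l] [DecidableEq l] (B B' : Matrix m l F)
    (h : B.rank = B'.rank) :
    ∃ (U : Matrix m m F) (V : Matrix l l F), IsUnit U ∧ IsUnit V ∧ U * B = B' * V := by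
  obtain ⟨e, e', he⟩ :=
    LinearMap.exists_equiv_comp_eq_of_finrank_range_eq (toLin' B) (toLin' B') h
  refine ⟨LinearMap.toMatrix' e'.toLinearMap, LinearMap.toMatrix' e.toLinearMap, ?_, ?_, ?_⟩
  · exact LinearMap.isUnit_toMatrix'_iff.2 ((Module.End.isUnit_iff _).2 e'.bijective)
  · exact LinearMap.isUnit_toMatrix'_iff.2 ((Module.End.isUnit_iff _).2 e.bijective)
  · simpa [LinearMap.toMatrix'_comp] using congrArg LinearMap.toMatrix' he

/-- Pairing with a nonzero matrix through the trace is surjective onto the field. -/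
theorem Matrix.exists_trace_mul_eq {F m l : Type*} [Field F] [Fintype m] [Fintype l]
    {M : Matrix m l F} (hM : M ≠ 0) (c : F) : ∃ A : Matrix l m F, (M * A).trace = c := by
  classical
  obtain ⟨i, j, hij⟩ : ∃ i j, M i j ≠ 0 := by
    by_contra! h
    exact hM (Matrix.ext h)
  refine ⟨single j i (c / M i j), ?_⟩
  rw [trace_mul_single, op_smul_eq_mul, mul_comm, div_mul_cancel₀ _ hij]

/-- Orbit classification: two pairs `(B, λ)` and `(B', λ')`, with `B, B'` nonzero,
lie in the same orbit of the adapted-linear-group action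
`(N,K,A) • (B,λ) = (det N)⁻¹ • (N B K⁻¹, λ − tr (B K⁻¹ A))`
if and only if `B` and `B'` have the same rank. -/
theorem adapted_orbits_classified_by_rank (n k : ℕ) (hn : 1 ≤ n) (hk : 1 ≤ k)
    (B B' : Matrix (Fin n) (Fin k) ℝ) (hB : B ≠ 0) (hB' : B' ≠ 0) (lam lam' : ℝ) :
    (∃ (N : Matrix (Fin n) (Fin n) ℝ) (K : Matrix (Fin k) (Fin k) ℝ)
        (A : Matrix (Fin k) (Fin n) ℝ), IsUnit N ∧ IsUnit K ∧
        (N.det)⁻¹ • ((N * B * K⁻¹, lam - (B * K⁻¹ * A).trace) :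
            Matrix (Fin n) (Fin k) ℝ × ℝ) = (B', lam')) ↔
      B.rank = B'.rank := by
  constructor
  · rintro ⟨N, K, A, hN, hK, h⟩
    rw [isUnit_iff_isUnit_det] at hN hK
    have hB'_eq : B' = ((N.det)⁻¹ • N) * B * K⁻¹ := by
      simpa using (congrArg Prod.fst h).symm
    have hN' : IsUnit ((N.det)⁻¹ • N).det := by
      rw [det_smul]
      exact ((isUnit_iff_ne_zero.2 (inv_ne_zero hN.ne_zero)).pow _).mul hN
    rw [hB'_eq, rank_mul_eq_left_of_isUnit_det _ _ (isUnit_nonsing_inv_det _ hK),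
      rank_mul_eq_right_of_isUnit_det _ _ hN']
  · intro h
    obtain ⟨N, V, hN, hV, hNV⟩ := exists_isUnit_mul_mul_eq_of_rank_eq B B' h
    have hd : N.det ≠ 0 := ((isUnit_iff_isUnit_det _).1 hN).ne_zero
    have hVd : IsUnit V.det := (isUnit_iff_isUnit_det _).1 hV
    have hW : IsUnit (N.det • V⁻¹) := by
      rw [isUnit_iff_isUnit_det, det_smul]
      exact ((isUnit_iff_ne_zero.2 hd).pow _).mul (isUnit_nonsing_inv_det _ hVd)
    have hWd := (isUnit_iff_isUnit_det _).1 hW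
    have hne : B * (N.det • V⁻¹) ≠ 0 := by
      intro h0
      apply hB
      rw [← mul_nonsing_inv_cancel_right _ B hWd, h0, Matrix.zero_mul]
    obtain ⟨A, hA⟩ := exists_trace_mul_eq hne (lam - N.det * lam')
    refine ⟨N, (N.det • V⁻¹)⁻¹, A, hN, ?_, ?_⟩
    · exact (isUnit_iff_isUnit_det _).2 (isUnit_nonsing_inv_det _ hWd)
    · rw [nonsing_inv_nonsing_inv _ hWd, hA, hNV]
      simp [smul_smul, hd, mul_nonsing_inv_cancel_right _ B' hVd]
end

section
/- Let n, k ≥ 1, let η be a symmetric invertible n×n real matrix and ι a symmetric invertible k×k real matrix, and set G := fromBlocks η 0 0 ι. Let N be an invertible n×n real matrix, K an invertible k×k real matrix, A any k×n real matrix, and g := fromBlocks N 0 A K. Then gᵀ * G * g = G if and only if A = 0, Nᵀ * η * N = η, and Kᵀ * ι * K = ι. That is, the intersection of the adapted linear group with the orthogonal group of the block-diagonal metric G consists exactly of the block-diagonal matrices fromBlocks N 0 0 K with N η-orthogonal and K ι-orthogonal. -/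
open Matrix

/-- The intersection of the adapted linear group with the orthogonal group of the
block-diagonal metric `G = fromBlocks η 0 0 ι` (with `η`, `ι` symmetric and invertible)
consists exactly of the block-diagonal matrices `fromBlocks N 0 0 K` with `N`
η-orthogonal and `K` ι-orthogonal: for `g = fromBlocks N 0 A K` with `N, K` invertible,
`gᵀ * G * g = G` iff `A = 0`, `Nᵀ * η * N = η` and `Kᵀ * ι * K = ι`. -/
theorem adapted_inter_orthogonal (n k : ℕ) (hn : 1 ≤ n) (hk : 1 ≤ k)
    (η : Matrix (Fin n) (Fin n) ℝ) (hηsymm : ηᵀ = η) (hη : IsUnit η)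
    (ι : Matrix (Fin k) (Fin k) ℝ) (hιsymm : ιᵀ = ι) (hι : IsUnit ι)
    (N : Matrix (Fin n) (Fin n) ℝ) (hN : IsUnit N)
    (K : Matrix (Fin k) (Fin k) ℝ) (hK : IsUnit K)
    (A : Matrix (Fin k) (Fin n) ℝ) :
    (Matrix.fromBlocks N 0 A K)ᵀ * Matrix.fromBlocks η 0 0 ι * Matrix.fromBlocks N 0 A K =
        Matrix.fromBlocks η 0 0 ι ↔
      A = 0 ∧ Nᵀ * η * N = η ∧ Kᵀ * ι * K = ι := by
  rw [fromBlocks_transpose, fromBlocks_multiply, fromBlocks_multiply, fromBlocks_inj]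
  simp only [transpose_zero, Matrix.mul_zero, Matrix.zero_mul, add_zero, zero_add]
  constructor
  · rintro ⟨h₁₁, -, h₂₁, h₂₂⟩
    have hunit : IsUnit (Kᵀ * ι) := ((isUnit_transpose K).mpr hK).mul hι
    have hdet : IsUnit (Kᵀ * ι).det := (isUnit_iff_isUnit_det _).mp hunit
    have hA : A = 0 := by
      rw [← nonsing_inv_mul_cancel_left (Kᵀ * ι) A hdet, h₂₁, Matrix.mul_zero]
    subst hA
    exact ⟨rfl, by simpa using h₁₁, h₂₂⟩
  · rintro ⟨rfl, hN', hK'⟩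
    simp [hN', hK']
end

section
/- Let n ≥ 1 and k ≥ 1, and let V = ((Fin n ⊕ Fin k) → ℝ) with vertical subspace W = {v : V | v(inl i) = 0 for all i : Fin n}. For an n×k real matrix B and λ ∈ ℝ, let z_{(B,λ)} be the alternating n-linear form on V given by z_{(B,λ)}(v₁,…,vₙ) = λ·det X + Σ_{i=1}^{n} det Xⁱ, where X is the n×n matrix with entries X_{i j} = v_j(inl i) and Xⁱ is X with its i-th row replaced by the row j ↦ Σ_{A : Fin k} B_{i A} · v_j(inr A). Then the linear map (B,λ) ↦ z_{(B,λ)} from (Matrix (Fin n) (Fin k) ℝ) × ℝ into the space of alternating n-forms on V is injective, and its range is exactly the subspace Z₀ of alternating n-forms z such that z(v₁,…,vₙ) = 0 whenever at least two of the arguments v₁,…,vₙ lie in W. In particular, Z₀ has dimension n·k + 1. -/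
open Matrix

/-- `Z₀`: the subspace of alternating `n`-forms on `ℝ^{n+k}` that vanish whenever at
least two of their arguments lie in the vertical subspace
`W = {v | v (inl i) = 0 for all i}`.  This is the linear model of the fiber of the
multiphase space `Z`. -/
noncomputable def Zzero (n k : ℕ) : Submodule ℝ (AlternatingMap ℝ ((Fin n ⊕ Fin k) → ℝ) ℝ (Fin n)) where
  carrier := {z | ∀ v : Fin n → ((Fin n ⊕ Fin k) → ℝ), ∀ j₁ j₂ : Fin n, j₁ ≠ j₂ →
      (∀ i : Fin n, v j₁ (Sum.inl i) = 0) → (∀ i : Fin n, v j₂ (Sum.inl i) = 0) →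
      z v = 0}
  add_mem' := by
    intro a b ha hb v j₁ j₂ hj h1 h2
    simp [ha v j₁ j₂ hj h1 h2, hb v j₁ j₂ hj h1 h2]
  zero_mem' := by
    intro v j₁ j₂ hj h1 h2
    simp
  smul_mem' := by
    intro c a ha v j₁ j₂ hj h1 h2
    simp [ha v j₁ j₂ hj h1 h2]

/-- The alternating form `v ↦ det (f i (v j))` attached to a family `f` of linear functionals. -/
noncomputable def detForm {n : ℕ} {M : Type*} [AddCommGroup M] [Module ℝ M]
    (f : Fin n → M →ₗ[ℝ] ℝ) : AlternatingMap ℝ M ℝ (Fin n) :=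
  Matrix.detRowAlternating.compLinearMap (LinearMap.pi f)

theorem detForm_apply {n : ℕ} {M : Type*} [AddCommGroup M] [Module ℝ M]
    (f : Fin n → M →ₗ[ℝ] ℝ) (v : Fin n → M) :
    detForm f v = (Matrix.of fun i j => f i (v j)).det := by
  rw [← Matrix.det_transpose]
  rfl

theorem alternatingMap_sum_apply {R M N ι κ : Type*} [Semiring R] [AddCommMonoid M] [Module R M]
    [AddCommMonoid N] [Module R N] (s : Finset κ) (f : κ → AlternatingMap R M N ι) (v : ι → M) :
    (∑ i ∈ s, f i) v = ∑ i ∈ s, f i v := by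
  classical
  induction s using Finset.induction_on with
  | empty => simp
  | insert a s ha ih => simp [ha, ih]

/-- The form `z_{(B,λ)}`. -/
noncomputable def zForm {n k : ℕ} (B : Matrix (Fin n) (Fin k) ℝ) (lam : ℝ) :
    AlternatingMap ℝ ((Fin n ⊕ Fin k) → ℝ) ℝ (Fin n) :=
  lam • detForm (fun i => LinearMap.proj (Sum.inl i)) +
    ∑ i : Fin n, detForm (Function.update (fun r => LinearMap.proj (Sum.inl r)) i
      (∑ A : Fin k, B i A • LinearMap.proj (Sum.inr A)))

theorem zForm_apply {n k : ℕ} (B : Matrix (Fin n) (Fin k) ℝ) (lam : ℝ)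
    (v : Fin n → ((Fin n ⊕ Fin k) → ℝ)) :
    zForm B lam v =
      lam * (Matrix.of fun i j => v j (Sum.inl i)).det +
        ∑ i : Fin n, ((Matrix.of fun r j => v j (Sum.inl r)).updateRow i
            (fun j => ∑ A : Fin k, B i A * v j (Sum.inr A))).det := by
  simp only [zForm, AlternatingMap.add_apply, AlternatingMap.smul_apply, alternatingMap_sum_apply,
    detForm_apply, smul_eq_mul, LinearMap.proj_apply]
  congr 1
  refine Finset.sum_congr rfl fun i _ => ?_
  congr 1
  ext r j
  by_cases h : r = i
  · subst h
    simp
  · simp [h]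

/-- The linear map `(B, λ) ↦ z_{(B,λ)}`. -/
noncomputable def zFormLinear (n k : ℕ) : (Matrix (Fin n) (Fin k) ℝ × ℝ) →ₗ[ℝ]
    (AlternatingMap ℝ ((Fin n ⊕ Fin k) → ℝ) ℝ (Fin n)) where
  toFun p := zForm p.1 p.2
  map_add' p q := by
    ext v
    have h (i : Fin n) : (fun j => ∑ A : Fin k, (p.1 + q.1) i A * v j (Sum.inr A)) =
        (fun j => ∑ A : Fin k, p.1 i A * v j (Sum.inr A)) +
          fun j => ∑ A : Fin k, q.1 i A * v j (Sum.inr A) := by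
      ext j
      simp [add_mul, Finset.sum_add_distrib]
    simp only [AlternatingMap.add_apply, zForm_apply, Prod.fst_add, Prod.snd_add, h,
      Matrix.det_updateRow_add, Finset.sum_add_distrib]
    ring
  map_smul' c p := by
    ext v
    have h (i : Fin n) : (fun j => ∑ A : Fin k, (c • p.1) i A * v j (Sum.inr A)) =
        c • fun j => ∑ A : Fin k, p.1 i A * v j (Sum.inr A) := by
      ext j
      simp [Finset.mul_sum, mul_assoc]
    simp only [AlternatingMap.smul_apply, zForm_apply, Prod.smul_fst, Prod.smul_snd, h,
      Matrix.det_updateRow_smul, ← Finset.mul_sum, RingHom.id_apply, smul_eq_mul]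
    ring

theorem zForm_mem_Zzero {n k : ℕ} (B : Matrix (Fin n) (Fin k) ℝ) (lam : ℝ) :
    zForm B lam ∈ Zzero n k := by
  intro v j₁ j₂ hj h₁ h₂
  rw [zForm_apply, Matrix.det_eq_zero_of_column_eq_zero j₁ (by simpa using h₁), mul_zero, zero_add]
  refine Finset.sum_eq_zero fun i _ => ?_
  rw [Matrix.det_apply]
  refine Finset.sum_eq_zero fun σ _ => ?_
  obtain ⟨j, hv, hσ⟩ : ∃ j, (∀ r, v j (Sum.inl r) = 0) ∧ σ j ≠ i := by
    by_cases h : σ j₁ = i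
    · exact ⟨j₂, h₂, fun h' => hj (σ.injective (h.trans h'.symm))⟩
    · exact ⟨j₁, h₁, h⟩
  rw [Finset.prod_eq_zero (Finset.mem_univ j), smul_zero]
  simp [hσ, hv]

theorem zForm_apply_horizontal {n k : ℕ} (B : Matrix (Fin n) (Fin k) ℝ) (lam : ℝ) :
    zForm B lam (fun j => Pi.single (Sum.inl j) 1) = lam := by
  have h : (Matrix.of fun i j : Fin n =>
      (Pi.single (Sum.inl j) 1 : (Fin n ⊕ Fin k) → ℝ) (Sum.inl i)) = 1 := by
    ext i j
    simp [Pi.single_apply, Matrix.one_apply]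
  rw [zForm_apply, h, Matrix.det_one, mul_one, add_eq_left]
  refine Finset.sum_eq_zero fun i _ => Matrix.det_eq_zero_of_row_eq_zero i fun j => ?_
  simp

theorem zForm_apply_update {n k : ℕ} (B : Matrix (Fin n) (Fin k) ℝ) (lam : ℝ)
    (i : Fin n) (A : Fin k) :
    zForm B lam (Function.update (fun j => Pi.single (Sum.inl j) 1) i
      (Pi.single (Sum.inr A) 1)) = B i A := by
  set v : Fin n → (Fin n ⊕ Fin k) → ℝ :=
    Function.update (fun j => Pi.single (Sum.inl j) 1) i (Pi.single (Sum.inr A) 1) with hv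
  have hrow (j : Fin n) : v j (Sum.inl i) = 0 := by
    by_cases h : j = i
    · subst h
      simp [hv]
    · simp [hv, h, Ne.symm h]
  rw [zForm_apply, Matrix.det_eq_zero_of_row_eq_zero i hrow, mul_zero, zero_add,
    Finset.sum_eq_single i]
  · have h : (Matrix.of fun r j => v j (Sum.inl r)).updateRow i
        (fun j => ∑ A : Fin k, B i A * v j (Sum.inr A)) =
        Matrix.diagonal (Function.update 1 i (B i A)) := by
      ext r j
      by_cases hr : r = i
      · subst hr
        by_cases h : j = r
        · subst h
          simp [hv, Pi.single_apply]
        · simp [hv, h, Ne.symm h]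
      · by_cases h : j = i
        · subst h
          simp [hv, hr]
        · simp [hv, h, hr, Matrix.diagonal_apply, Pi.single_apply]
    rw [h, Matrix.det_diagonal, Finset.prod_update_of_mem (Finset.mem_univ i)]
    simp
  · intro r _ hr
    refine Matrix.det_eq_zero_of_row_eq_zero i fun j => ?_
    simp [hr.symm, hrow]
  · simp

/-- An injective family of basis indices with at most one index in the right summand is, up to a
permutation, `Sum.inl` with one value replaced. -/
theorem exists_perm_eq_update_inl {n : ℕ} {κ : Type*} {w : Fin n → Fin n ⊕ κ}
    (hw : Function.Injective w) {j₀ : Fin n} {A : κ} (hj₀ : w j₀ = Sum.inr A)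
    (hinl : ∀ j ≠ j₀, ∃ i, w j = Sum.inl i) :
    ∃ σ : Equiv.Perm (Fin n), w = Function.update Sum.inl (σ j₀) (Sum.inr A) ∘ σ := by
  classical
  choose! g hg using hinl
  obtain ⟨i, hi⟩ : ∃ i, i ∉ (Finset.univ.erase j₀).image g := by
    by_contra! h
    have h₁ := Finset.card_le_card (fun i _ => h i : Finset.univ ⊆ _)
    have h₂ := h₁.trans Finset.card_image_le
    rw [Finset.card_erase_of_mem (Finset.mem_univ _), Finset.card_univ, Fintype.card_fin] at h₂
    have := j₀.pos
    omega
  have hi' (j : Fin n) (hj : j ≠ j₀) : g j ≠ i := fun h =>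
    hi (Finset.mem_image.2 ⟨j, by simp [hj], h⟩)
  have hinj : Function.Injective (Function.update g j₀ i) := by
    intro a b hab
    by_cases ha : a = j₀ <;> by_cases hb : b = j₀
    · rw [ha, hb]
    · subst ha
      simp only [Function.update_self, Function.update_of_ne hb] at hab
      exact absurd hab.symm (hi' b hb)
    · subst hb
      simp only [Function.update_self, Function.update_of_ne ha] at hab
      exact absurd hab (hi' a ha)
    · simp only [Function.update_of_ne ha, Function.update_of_ne hb] at hab
      exact hw (by rw [hg a ha, hg b hb, hab])
  refine ⟨Equiv.ofBijective _ (Finite.injective_iff_bijective.1 hinj), ?_⟩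
  ext1 j
  by_cases hj : j = j₀
  · subst hj
    simp [hj₀]
  · simp [hj, hg j hj, hi' j hj]

theorem eq_zero_of_mem_Zzero {n k : ℕ}
    {z : AlternatingMap ℝ ((Fin n ⊕ Fin k) → ℝ) ℝ (Fin n)} (hz : z ∈ Zzero n k)
    (h₀ : z (fun j => Pi.single (Sum.inl j) 1) = 0)
    (h₁ : ∀ i A, z (Function.update (fun j => Pi.single (Sum.inl j) 1) i
      (Pi.single (Sum.inr A) 1)) = 0) : z = 0 := by
  refine Module.Basis.ext_alternating (Pi.basisFun ℝ (Fin n ⊕ Fin k)) fun w hw => ?_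
  simp only [Pi.basisFun_apply, AlternatingMap.zero_apply]
  by_cases hall : ∀ j, ∃ i, w j = Sum.inl i
  · choose g hg using hall
    have hinj : Function.Injective g := fun a b hab => hw (by rw [hg, hg, hab])
    have h := z.map_perm (fun j => Pi.single (Sum.inl j) 1)
      (Equiv.ofBijective g (Finite.injective_iff_bijective.1 hinj))
    rw [h₀, smul_zero] at h
    simp only [hg]
    exact h
  push Not at hall
  obtain ⟨j₀, hj₀⟩ := hall
  obtain ⟨A, hA⟩ : ∃ A, w j₀ = Sum.inr A := by
    cases h : w j₀ with
    | inl i => exact absurd h (hj₀ i)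
    | inr A => exact ⟨A, rfl⟩
  by_cases hrest : ∀ j ≠ j₀, ∃ i, w j = Sum.inl i
  · obtain ⟨σ, hσ⟩ := exists_perm_eq_update_inl hw hA hrest
    have h := z.map_perm (Function.update (fun j => Pi.single (Sum.inl j) 1) (σ j₀)
      (Pi.single (Sum.inr A) 1)) σ
    rw [h₁, smul_zero] at h
    rw [← h, hσ]
    congr 1
    ext1 j
    by_cases hj : j = j₀
    · subst hj
      simp
    · simp [hj]
  · push Not at hrest
    obtain ⟨j₁, hne, hj₁⟩ := hrest
    refine hz _ j₁ j₀ hne (fun i => ?_) fun i => ?_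
    · simp [(hj₁ i).symm]
    · simp [hA]

/-- The linear map `(B, λ) ↦ z_{(B,λ)}`, where
`z_{(B,λ)}(v₁,…,vₙ) = λ·det X + Σᵢ det Xⁱ` with `X_{i j} = v_j (inl i)` and `Xⁱ` equal
to `X` with its `i`-th row replaced by `j ↦ Σ_A B_{i A} · v_j (inr A)`, is injective,
and its range is exactly the subspace `Z₀` of alternating `n`-forms vanishing whenever
at least two arguments are vertical.  In particular `Z₀` has dimension `n·k + 1`. -/
theorem zForms_inject_onto_Zzero (n k : ℕ) (hn : 1 ≤ n) (hk : 1 ≤ k) :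
    ∃ Φ : (Matrix (Fin n) (Fin k) ℝ × ℝ) →ₗ[ℝ]
        (AlternatingMap ℝ ((Fin n ⊕ Fin k) → ℝ) ℝ (Fin n)),
      (∀ (B : Matrix (Fin n) (Fin k) ℝ) (lam : ℝ)
          (v : Fin n → ((Fin n ⊕ Fin k) → ℝ)),
        Φ (B, lam) v =
          lam * (Matrix.of fun i j => v j (Sum.inl i)).det +
            ∑ i : Fin n, ((Matrix.of fun r j => v j (Sum.inl r)).updateRow i
                (fun j => ∑ A : Fin k, B i A * v j (Sum.inr A))).det) ∧
      Function.Injective Φ ∧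
      LinearMap.range Φ = Zzero n k ∧
      Module.finrank ℝ (Zzero n k) = n * k + 1 := by
  have hinj : Function.Injective (zFormLinear n k) := by
    rw [injective_iff_map_eq_zero]
    rintro ⟨B, lam⟩ h
    have h' : zForm B lam = 0 := h
    ext i A
    · simpa [h'] using (zForm_apply_update B lam i A).symm
    · simpa [h'] using (zForm_apply_horizontal B lam).symm
  have hrange : LinearMap.range (zFormLinear n k) = Zzero n k := by
    refine le_antisymm ?_ fun z hz => ?_
    · rintro _ ⟨⟨B, lam⟩, rfl⟩
      exact zForm_mem_Zzero B lam
    · let B : Matrix (Fin n) (Fin k) ℝ := Matrix.of fun i A =>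
        z (Function.update (fun j => Pi.single (Sum.inl j) 1) i (Pi.single (Sum.inr A) 1))
      let lam : ℝ := z (fun j => Pi.single (Sum.inl j) 1)
      refine ⟨(B, lam), (sub_eq_zero.1 (eq_zero_of_mem_Zzero
        (Submodule.sub_mem _ hz (zForm_mem_Zzero B lam)) ?_ fun i A => ?_)).symm⟩
      · rw [AlternatingMap.sub_apply, zForm_apply_horizontal, sub_self]
      · rw [AlternatingMap.sub_apply, zForm_apply_update]
        exact sub_self _
  refine ⟨zFormLinear n k, fun B lam v => zForm_apply B lam v, hinj, hrange, ?_⟩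
  rw [← hrange, LinearMap.finrank_range_of_inj hinj]
  simp [Module.finrank_matrix]
end

section
/- Let n ≥ 1 and k ≥ 1, and let V = ((Fin n ⊕ Fin k) → ℝ). For an n×k real matrix B and λ ∈ ℝ, let z_{(B,λ)} be the alternating n-linear form on V given by z_{(B,λ)}(v₁,…,vₙ) = λ·det X + Σ_{i=1}^{n} det Xⁱ, where X is the n×n matrix with entries X_{i j} = v_j(inl i) and Xⁱ is X with its i-th row replaced by the row j ↦ Σ_{A : Fin k} B_{i A} · v_j(inr A). Let N be an invertible n×n real matrix, K an invertible k×k real matrix, A a k×n real matrix, and g := fromBlocks N 0 A K. Then the pullback of z_{(B,λ)} by g equals z_{(B',λ')}, i.e., z_{(B,λ)}(g.mulVec v₁, …, g.mulVec vₙ) = z_{(B',λ')}(v₁,…,vₙ) for all v₁,…,vₙ ∈ V, where B' = det N • (N⁻¹ * B * K) and λ' = det N • (λ + trace (N⁻¹ * B * A)). -/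
open Matrix

/-- The alternating `n`-form `z_{(B,λ)}` on `ℝ^{n+k}`, given as a scalar function of
`n` vectors: `z_{(B,λ)}(v₁,…,vₙ) = λ·det X + Σᵢ det Xⁱ`, where `X_{i j} = v_j (inl i)`
and `Xⁱ` is `X` with its `i`-th row replaced by `j ↦ Σ_A B_{i A} · v_j (inr A)`. -/
def zFun (n k : ℕ) (B : Matrix (Fin n) (Fin k) ℝ) (lam : ℝ)
    (v : Fin n → ((Fin n ⊕ Fin k) → ℝ)) : ℝ :=
  lam * (Matrix.of fun i j => v j (Sum.inl i)).det +
    ∑ i : Fin n, ((Matrix.of fun r j => v j (Sum.inl r)).updateRow i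
        (fun j => ∑ A : Fin k, B i A * v j (Sum.inr A))).det

theorem sum_det_updateRow_eq_trace_mul_adjugate {ι R : Type*} [Fintype ι] [DecidableEq ι]
    [CommRing R] (X M : Matrix ι ι R) :
    ∑ i, (X.updateRow i (M i)).det = (M * X.adjugate).trace := by
  refine Finset.sum_congr rfl fun i _ => ?_
  rw [← cramer_transpose_apply, cramer_eq_adjugate_mulVec, ← adjugate_transpose,
    mulVec_transpose, diag_apply, mul_apply_eq_vecMul]

theorem zFun_eq_trace (n k : ℕ) (B : Matrix (Fin n) (Fin k) ℝ) (lam : ℝ)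
    (v : Fin n → ((Fin n ⊕ Fin k) → ℝ)) :
    zFun n k B lam v =
      lam * (Matrix.of fun i j => v j (Sum.inl i)).det +
        (B * (Matrix.of fun a j => v j (Sum.inr a)) *
          (Matrix.of fun i j => v j (Sum.inl i)).adjugate).trace := by
  rw [← sum_det_updateRow_eq_trace_mul_adjugate]
  rfl

/-- Equivariance of the forms `z_{(B,λ)}` under the adapted linear group: the pullback
of `z_{(B,λ)}` by `g = fromBlocks N 0 A K` equals `z_{(B',λ')}`, where
`B' = det N • (N⁻¹ * B * K)` and `λ' = det N • (λ + tr (N⁻¹ * B * A))`. -/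
theorem zFun_pullback (n k : ℕ) (hn : 1 ≤ n) (hk : 1 ≤ k)
    (B : Matrix (Fin n) (Fin k) ℝ) (lam : ℝ)
    (N : Matrix (Fin n) (Fin n) ℝ) (hN : IsUnit N)
    (K : Matrix (Fin k) (Fin k) ℝ) (hK : IsUnit K)
    (A : Matrix (Fin k) (Fin n) ℝ) :
    ∀ v : Fin n → ((Fin n ⊕ Fin k) → ℝ),
      zFun n k B lam (fun j => (Matrix.fromBlocks N 0 A K).mulVec (v j)) =
        zFun n k (N.det • (N⁻¹ * B * K)) (N.det • (lam + (N⁻¹ * B * A).trace)) v := by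
  intro v
  set X : Matrix (Fin n) (Fin n) ℝ := Matrix.of fun i j => v j (Sum.inl i) with hX
  set Y : Matrix (Fin k) (Fin n) ℝ := Matrix.of fun a j => v j (Sum.inr a) with hY
  have hXN : (Matrix.of fun i j => (fromBlocks N 0 A K).mulVec (v j) (Sum.inl i)) = N * X := by
    ext i j
    simp [hX, mulVec, dotProduct, mul_apply]
  have hYK : (Matrix.of fun a j => (fromBlocks N 0 A K).mulVec (v j) (Sum.inr a)) =
      A * X + K * Y := by
    ext i j
    simp [hX, hY, mulVec, dotProduct, mul_apply]
  have hadj : N.adjugate = N.det • N⁻¹ := by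
    rw [inv_def, smul_smul, Ring.mul_inverse_cancel _ ((isUnit_iff_isUnit_det N).mp hN), one_smul]
  have hA : (B * (A * X) * (X.adjugate * N⁻¹)).trace = X.det * (N⁻¹ * B * A).trace := by
    rw [show B * (A * X) * (X.adjugate * N⁻¹) = B * A * (X * X.adjugate) * N⁻¹ by
      simp only [Matrix.mul_assoc], mul_adjugate, trace_mul_comm]
    simp [Matrix.mul_assoc]
  have hK' : (B * (K * Y) * (X.adjugate * N⁻¹)).trace = (N⁻¹ * B * K * Y * X.adjugate).trace := by
    rw [← Matrix.mul_assoc, trace_mul_comm]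
    simp only [Matrix.mul_assoc]
  rw [zFun_eq_trace, zFun_eq_trace, hXN, hYK, ← hX, ← hY, adjugate_mul_distrib, hadj, det_mul]
  simp only [Matrix.mul_add, Matrix.add_mul, Matrix.mul_smul, Matrix.smul_mul, trace_add,
    trace_smul, smul_eq_mul, hA, hK']
  ring
end
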